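/- arXiv:1403.0518 — 2 statements merged into one kernel-verified Lean document; each statement's English description precedes it below -/
import Mathlib

section
/- Let μ be the unique Green's function type bound: for U ⊂ ℝ² a bounded convex domain with x' ∈ U, let Ψ be the harmonic function in U with boundary values Ψ(s) = −(1/2π) log|s − x'|. Then |∇Ψ(x)| ≤ C/|x − x'| for all x ∈ U, with C a constant independent of the domain U. -/
noncomputable section
open Real Metric

abbrev E2 := EuclideanSpace ℝ (Fin 2)

open InnerProductSpace in
/-- **Maximum principle** for harmonic functions on a bounded open subset of the plane. -/
theorem nonpos_of_harmonicOnNhd {V : Set ℂ} {u : ℂ → ℝ} (hVo : IsOpen V)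
    (hVb : Bornology.IsBounded V) (hu : HarmonicOnNhd u V) (huc : ContinuousOn u (closure V))
    (hbd : ∀ s ∈ closure V, s ∉ V → u s ≤ 0) : ∀ z ∈ V, u z ≤ 0 := by
  intro z hz
  by_contra! hpos
  have hK : IsCompact (closure V) := hVb.isCompact_closure
  obtain ⟨c₀, hc₀, hmax⟩ := hK.exists_isMaxOn ⟨z, subset_closure hz⟩ huc
  have hM : 0 < u c₀ := hpos.trans_le (hmax (subset_closure hz))
  have hK' : IsCompact (closure V ∩ u ⁻¹' {u c₀}) :=
    hK.of_isClosed_subset (huc.preimage_isClosed_of_isClosed isClosed_closure isClosed_singleton)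
      Set.inter_subset_left
  -- among the maximum points, take a rightmost one
  obtain ⟨c, ⟨hcV, hcu⟩, hright⟩ := hK'.exists_isMaxOn ⟨c₀, hc₀, rfl⟩
    Complex.continuous_re.continuousOn
  have hcu : u c = u c₀ := hcu
  have hc : c ∈ V := by
    by_contra hc
    linarith [hbd c hcV hc]
  obtain ⟨ε, hε, hball⟩ := Metric.isOpen_iff.1 hVo c hc
  obtain ⟨F, hF, hFu⟩ := (hu.mono hball).exists_analyticOnNhd_ball_re_eq
  have hFu : ∀ w ∈ ball c ε, (F w).re = u w := fun w hw => hFu hw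
  have hloc : IsLocalMax (norm ∘ fun w => Complex.exp (F w)) c := by
    filter_upwards [ball_mem_nhds c hε] with w hw
    simp only [Function.comp_apply, Complex.norm_exp, hFu w hw, hFu c (mem_ball_self hε), hcu]
    exact exp_le_exp.2 (hmax (subset_closure (hball hw)))
  have hconst := Complex.norm_eventually_eq_of_isLocalMax (by
    filter_upwards [ball_mem_nhds c hε] with w hw
    exact (hF w hw).differentiableAt.cexp) hloc
  obtain ⟨η, hη, hηc⟩ := Metric.eventually_nhds_iff_ball.1
    (hconst.and (ball_mem_nhds c hε))
  have hw : c + (η / 2 : ℝ) ∈ ball c η := by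
    simp [abs_of_pos hη, hη]
  obtain ⟨h1, h2⟩ := hηc _ hw
  rw [Complex.norm_exp, Complex.norm_exp, Real.exp_eq_exp, hFu _ h2,
    hFu _ (mem_ball_self hε), hcu] at h1
  have h3 : (c + (η / 2 : ℝ)).re ≤ c.re := hright ⟨subset_closure (hball h2), h1⟩
  rw [Complex.add_re, Complex.ofReal_re] at h3
  linarith

open InnerProductSpace in
/-- Gradient estimate for positive harmonic functions on a disc, at the centre. -/
theorem norm_fderiv_le_of_harmonicOnNhd_of_pos {u : ℂ → ℝ} {x : ℂ} {ρ : ℝ} (hρ : 0 < ρ)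
    (hu : HarmonicOnNhd u (ball x ρ)) (hpos : ∀ z ∈ ball x ρ, 0 < u z) :
    ‖fderiv ℝ u x‖ ≤ 2 * u x / ρ := by
  obtain ⟨F, hF, hFu⟩ := hu.exists_analyticOnNhd_ball_re_eq
  have hx : x ∈ ball x ρ := mem_ball_self hρ
  have hre : ∀ z ∈ ball x ρ, (F z).re = u z := fun z hz => hFu hz
  have hden : ∀ z ∈ ball x ρ, F z + star (F x) ≠ 0 := by
    intro z hz h
    have := congrArg Complex.re h
    simp [hre z hz, hre x hx] at this
    linarith [hpos z hz, hpos x hx]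
  -- the Cayley transform of the holomorphic function with real part `u`
  set w : ℂ → ℂ := fun z => (F z - F x) / (F z + star (F x)) with hw
  have hmaps : Set.MapsTo w (ball x ρ) (ball (w x) 1) := by
    intro z hz
    have hwx : w x = 0 := by simp [hw]
    rw [hwx, mem_ball_zero_iff, hw]
    simp only [norm_div]
    rw [div_lt_one (norm_pos_iff.2 (hden z hz))]
    refine lt_of_pow_lt_pow_left₀ 2 (norm_nonneg _) ?_
    rw [← Complex.normSq_eq_norm_sq, ← Complex.normSq_eq_norm_sq, Complex.normSq_apply,
      Complex.normSq_apply]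
    simp only [Complex.sub_re, Complex.sub_im, Complex.add_re, Complex.add_im, Complex.star_def,
      Complex.conj_re, Complex.conj_im, hre z hz, hre x hx]
    nlinarith [mul_pos (hpos z hz) (hpos x hx)]
  have hdw : DifferentiableOn ℂ w (ball x ρ) := fun z hz =>
    (((hF z hz).differentiableAt.sub_const _).div
      ((hF z hz).differentiableAt.add_const _) (hden z hz)).differentiableWithinAt
  have hS := Complex.norm_deriv_le_div_of_mapsTo_ball hdw
    (hmaps.mono_right ball_subset_closedBall) hρ
  have hFd : HasDerivAt F (deriv F x) x := (hF x hx).differentiableAt.hasDerivAt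
  have hwd : deriv w x = deriv F x / (2 * u x : ℝ) := by
    have h := ((hFd.sub_const (F x)).div (hFd.add_const (star (F x))) (hden x hx)).deriv
    have hs : F x + star (F x) = ((2 * u x : ℝ) : ℂ) := by
      rw [Complex.star_def, Complex.add_conj, hre x hx]
    have h0 : ((2 * u x : ℝ) : ℂ) ≠ 0 := hs ▸ hden x hx
    refine h.trans ?_
    rw [hs, sub_self, zero_mul, sub_zero]
    field_simp
  have hux := hpos x hx
  rw [hwd, norm_div, Complex.norm_real, Real.norm_of_nonneg (by positivity),
    div_le_div_iff₀ (by positivity) hρ, one_mul] at hS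
  have hfd : HasFDerivAt u (Complex.reCLM.comp
      ((ContinuousLinearMap.toSpanSingleton ℂ (deriv F x)).restrictScalars ℝ)) x := by
    refine (Complex.reCLM.hasFDerivAt.comp x
      (hFd.hasFDerivAt.restrictScalars ℝ)).congr_of_eventuallyEq ?_
    filter_upwards [ball_mem_nhds x hρ] with z hz
    exact (hre z hz).symm
  rw [hfd.fderiv, le_div_iff₀ hρ]
  refine le_trans (mul_le_mul_of_nonneg_right ?_ hρ.le) hS
  refine ContinuousLinearMap.opNorm_le_bound _ (norm_nonneg _) fun v => ?_
  refine (Complex.abs_re_le_norm _).trans ?_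
  simp [mul_comm]

open InnerProductSpace in
/-- Gradient estimate for nonnegative harmonic functions on a disc, at the centre. -/
theorem norm_fderiv_le_of_harmonicOnNhd_of_nonneg {u : ℂ → ℝ} {x : ℂ} {ρ : ℝ} (hρ : 0 < ρ)
    (hu : HarmonicOnNhd u (ball x ρ)) (hnn : ∀ z ∈ ball x ρ, 0 ≤ u z) :
    ‖fderiv ℝ u x‖ ≤ 2 * u x / ρ := by
  have key : ∀ ε > 0, ‖fderiv ℝ u x‖ ≤ 2 * u x / ρ + ε := by
    intro ε hε
    have h := norm_fderiv_le_of_harmonicOnNhd_of_pos (u := fun z => u z + ε * ρ / 2) hρ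
      (fun z hz => (hu z hz).add (harmonicAt_const _))
      (fun z hz => by have := hnn z hz; positivity)
    rw [fderiv_add_const] at h
    refine h.trans_eq ?_
    field_simp
  exact le_of_forall_pos_le_add key

open InnerProductSpace in
theorem harmonicAt_log_norm_sub {a z : ℂ} (hz : z ≠ a) :
    HarmonicAt (fun w : ℂ => log ‖w - a‖) z :=
  AnalyticAt.harmonicAt_log_norm (f := fun w => w - a) (by fun_prop) (sub_ne_zero.2 hz)

theorem continuousOn_log_norm_sub {a : ℂ} {S : Set ℂ} (ha : a ∉ S) :
    ContinuousOn (fun w : ℂ => log ‖w - a‖) S := by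
  refine ContinuousOn.log (by fun_prop) fun w hw => ?_
  rw [norm_ne_zero_iff, sub_ne_zero]
  exact ne_of_mem_of_not_mem hw ha

theorem norm_fderiv_log_norm_sub_le {a x : ℂ} (hx : x ≠ a) :
    ‖fderiv ℝ (fun w : ℂ => log ‖w - a‖) x‖ ≤ 4 / ‖x - a‖ := by
  have hr : 0 < ‖x - a‖ := norm_pos_iff.2 (sub_ne_zero.2 hx)
  have hfar : ∀ z ∈ ball x (‖x - a‖ / 2), ‖x - a‖ / 2 < ‖z - a‖ := by
    intro z hz
    rw [mem_ball, dist_eq_norm, norm_sub_rev] at hz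
    have := norm_sub_le_norm_sub_add_norm_sub x z a
    linarith
  have h := norm_fderiv_le_of_harmonicOnNhd_of_nonneg (x := x) (half_pos hr)
    (u := fun z => log ‖z - a‖ - log (‖x - a‖ / 2))
    (fun z hz => (harmonicAt_log_norm_sub (a := a) (z := z) (by
      rintro rfl
      have := hfar z hz
      rw [sub_self, norm_zero] at this
      linarith)).sub (InnerProductSpace.harmonicAt_const _))
    (fun z hz => sub_nonneg.2 (log_le_log (half_pos hr) (hfar z hz).le))
  rw [fderiv_sub_const] at h
  refine h.trans ?_
  have h2 : log ‖x - a‖ - log (‖x - a‖ / 2) ≤ 1 := by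
    rw [← log_div hr.ne' (half_pos hr).ne']
    refine (log_le_sub_one_of_pos (by positivity)).trans_eq ?_
    field_simp
    norm_num
  rw [div_le_div_iff₀ (half_pos hr) hr]
  nlinarith

/-- A point `p` outside an open convex set lies on a line bounding an open half-plane that contains
the set; reflecting a point `a` of the set across the line gives `b`. -/
theorem exists_reflection_of_notMem_convex {U : Set ℂ} (hUo : IsOpen U) (hUc : Convex ℝ U)
    {p a x : ℂ} (hp : p ∉ U) (ha : a ∈ U) (hx : x ∈ U) :
    ∃ b : ℂ, b ∉ closure U ∧ (∀ s ∈ closure U, ‖s - a‖ ≤ ‖s - b‖) ∧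
      ‖x - b‖ ^ 2 ≤ ‖x - a‖ ^ 2 + 4 * ‖x - p‖ * (‖x - p‖ + ‖x - a‖) := by
  obtain ⟨f, hf⟩ := geometric_hahn_banach_open_point hUc hUo hp
  obtain ⟨v, rfl⟩ := (InnerProductSpace.toDual ℝ ℂ).surjective f
  simp only [InnerProductSpace.toDual_apply_apply] at hf
  have hv : v ≠ 0 := by
    rintro rfl
    simpa using hf a ha
  have hvn : 0 < ‖v‖ := norm_pos_iff.2 hv
  set n : ℂ := ‖v‖⁻¹ • v with hn
  have hn1 : ‖n‖ = 1 := by rw [hn, norm_smul, norm_inv, norm_norm, inv_mul_cancel₀ hvn.ne']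
  have hlt : ∀ y ∈ U, inner ℝ n y < inner ℝ n p := by
    intro y hy
    simp only [hn, real_inner_smul_left]
    exact mul_lt_mul_of_pos_left (hf y hy) (inv_pos.2 hvn)
  have hle : ∀ y ∈ closure U, inner ℝ n y ≤ inner ℝ n p := by
    intro y hy
    have hcl : IsClosed {y : ℂ | inner ℝ n y ≤ inner ℝ n p} :=
      isClosed_le (by fun_prop) continuous_const
    exact closure_minimal (fun y hy => (hlt y hy).le) hcl hy
  set δ : ℝ := inner ℝ n p - inner ℝ n a with hδ
  have hδ0 : 0 < δ := sub_pos.2 (hlt a ha)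
  have hsq : ∀ s : ℂ, ‖s - (a + (2 * δ) • n)‖ ^ 2 =
      ‖s - a‖ ^ 2 + 4 * δ * (inner ℝ n p - inner ℝ n s) := by
    intro s
    rw [← sub_sub, norm_sub_sq_real, real_inner_smul_right, norm_smul, hn1, real_inner_comm,
      inner_sub_right, Real.norm_of_nonneg (by positivity), hδ]
    ring
  refine ⟨a + (2 * δ) • n, fun hb => ?_, fun s hs => ?_, ?_⟩
  · have h := hle _ hb
    rw [inner_add_right, real_inner_smul_right, real_inner_self_eq_norm_sq, hn1] at h
    linarith
  · refine le_of_sq_le_sq ?_ (norm_nonneg _)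
    rw [hsq]
    nlinarith [mul_nonneg hδ0.le (sub_nonneg.2 (hle s hs))]
  · rw [hsq]
    have hcs : ∀ y : ℂ, |inner ℝ n y| ≤ ‖y‖ := fun y => by
      simpa [hn1] using abs_real_inner_le_norm n y
    have h1 : inner ℝ n p - inner ℝ n x ≤ ‖x - p‖ := by
      rw [← inner_sub_right, norm_sub_rev]
      exact (le_abs_self _).trans (hcs _)
    have h2 : inner ℝ n x - inner ℝ n a ≤ ‖x - a‖ := by
      rw [← inner_sub_right]
      exact (le_abs_self _).trans (hcs _)
    have h3 : 0 < inner ℝ n p - inner ℝ n x := sub_pos.2 (hlt x hx)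
    have h4 : δ * (inner ℝ n p - inner ℝ n x) ≤ (‖x - p‖ + ‖x - a‖) * ‖x - p‖ :=
      mul_le_mul (by linarith) h1 h3.le (by positivity)
    linarith

section LogBoundaryData

open InnerProductSpace

variable {U : Set ℂ} {a : ℂ} {h : ℂ → ℝ}

/-- A harmonic function with boundary values `log ‖s - a‖` is at least `log m` if the boundary has
distance at least `m` to `a`. -/
theorem log_le_of_harmonic_of_frontier (hUo : IsOpen U) (hUb : Bornology.IsBounded U)
    (hh : HarmonicOnNhd h U) (hc : ContinuousOn h (closure U))
    (hbd : ∀ s ∈ frontier U, h s = log ‖s - a‖) {m : ℝ} (hm : 0 < m)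
    (hma : ∀ s ∉ U, m ≤ ‖s - a‖) {z : ℂ} (hz : z ∈ U) : log m ≤ h z := by
  refine sub_nonpos.1 (nonpos_of_harmonicOnNhd (u := fun w => log m - h w) hUo hUb
    (fun w hw => (harmonicAt_const _).sub (hh w hw)) (continuousOn_const.sub hc) ?_ z hz)
  intro s hs hsU
  rw [hbd s (hUo.frontier_eq ▸ ⟨hs, hsU⟩), sub_nonpos]
  exact log_le_log hm (hma s hsU)

/-- Nonpositivity of the Dirichlet Green's function. -/
theorem log_norm_sub_le_of_harmonic_of_frontier (hUo : IsOpen U) (hUb : Bornology.IsBounded U)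
    (ha : a ∈ U) (hh : HarmonicOnNhd h U) (hc : ContinuousOn h (closure U))
    (hbd : ∀ s ∈ frontier U, h s = log ‖s - a‖) {z : ℂ} (hz : z ∈ U) (hza : z ≠ a) :
    log ‖z - a‖ ≤ h z := by
  obtain ⟨m, hm, hball⟩ := Metric.isOpen_iff.1 hUo a ha
  have hma : ∀ s ∉ U, m ≤ ‖s - a‖ := fun s hs => by
    by_contra! hlt
    exact hs (hball (mem_ball_iff_norm.2 hlt))
  have hnear : ∀ w ∈ U, w ≠ a → ‖w - a‖ ≤ m → log ‖w - a‖ ≤ h w := fun w hw hwa hwm =>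
    (log_le_log (norm_pos_iff.2 (sub_ne_zero.2 hwa)) hwm).trans
      (log_le_of_harmonic_of_frontier hUo hUb hh hc hbd hm hma hw)
  rcases le_or_gt ‖z - a‖ m with hzm | hzm
  · exact hnear z hz hza hzm
  set V : Set ℂ := U ∩ (closedBall a m)ᶜ
  have hVcl : closure V ⊆ (ball a m)ᶜ :=
    closure_minimal (fun w hw hw' => hw.2 (ball_subset_closedBall hw')) isOpen_ball.isClosed_compl
  have hne : ∀ w ∈ closure V, w ≠ a := by
    rintro w hw rfl
    exact hVcl hw (mem_ball_self hm)
  have hVU : closure V ⊆ closure U := closure_mono Set.inter_subset_left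
  refine sub_nonpos.1 (nonpos_of_harmonicOnNhd (V := V) (u := fun w => log ‖w - a‖ - h w)
    (hUo.inter isClosed_closedBall.isOpen_compl) (hUb.subset Set.inter_subset_left)
    (fun w hw => (harmonicAt_log_norm_sub (hne w (subset_closure hw))).sub (hh w hw.1))
    ((continuousOn_log_norm_sub fun hw => hne a hw rfl).sub (hc.mono hVU)) ?_ z
    ⟨hz, fun hz' => hzm.not_ge (mem_closedBall_iff_norm.1 hz')⟩)
  intro s hs hsV
  by_cases hsU : s ∈ U
  · have hsm : s ∈ closedBall a m := by
      by_contra hsm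
      exact hsV ⟨hsU, hsm⟩
    exact sub_nonpos.2 (hnear s hsU (hne s hs) (mem_closedBall_iff_norm.1 hsm))
  · rw [hbd s (hUo.frontier_eq ▸ ⟨hVU hs, hsU⟩), sub_self]

/-- Comparison with the Green's function of a half-plane containing `U`. -/
theorem le_log_norm_sub_of_harmonic_of_frontier (hUo : IsOpen U) (hUb : Bornology.IsBounded U)
    (ha : a ∈ U) (hh : HarmonicOnNhd h U) (hc : ContinuousOn h (closure U))
    (hbd : ∀ s ∈ frontier U, h s = log ‖s - a‖) {b : ℂ} (hb : b ∉ closure U)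
    (hab : ∀ s ∈ closure U, ‖s - a‖ ≤ ‖s - b‖) {z : ℂ} (hz : z ∈ U) :
    h z ≤ log ‖z - b‖ := by
  refine sub_nonpos.1 (nonpos_of_harmonicOnNhd (u := fun w => h w - log ‖w - b‖) hUo hUb
    (fun w hw => (hh w hw).sub
      (harmonicAt_log_norm_sub (ne_of_mem_of_not_mem (subset_closure hw) hb)))
    (hc.sub (continuousOn_log_norm_sub hb)) ?_ z hz)
  intro s hs hsU
  rw [hbd s (hUo.frontier_eq ▸ ⟨hs, hsU⟩), sub_nonpos]
  exact log_le_log (norm_pos_iff.2 (sub_ne_zero.2 (ne_of_mem_of_not_mem ha hsU).symm)) (hab s hs)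

/-- Gradient bound for a harmonic function on a bounded convex open set with boundary values
`log ‖s - a‖`. -/
theorem norm_fderiv_le_of_harmonic_of_frontier (hUo : IsOpen U) (hUc : Convex ℝ U)
    (hUb : Bornology.IsBounded U) (ha : a ∈ U) (hh : HarmonicOnNhd h U)
    (hc : ContinuousOn h (closure U)) (hbd : ∀ s ∈ frontier U, h s = log ‖s - a‖)
    {x : ℂ} (hx : x ∈ U) (hxa : x ≠ a) : ‖fderiv ℝ h x‖ ≤ 28 / ‖x - a‖ := by
  have hne : (Uᶜ).Nonempty := by
    rw [Set.nonempty_compl]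
    rintro rfl
    exact NormedSpace.unbounded_univ ℝ ℂ hUb
  obtain ⟨p, hpU, hpd⟩ := hUo.isClosed_compl.exists_infDist_eq_dist hne x
  have hfar : ∀ s ∉ U, ‖x - p‖ ≤ ‖s - x‖ := fun s hs => by
    rw [← dist_eq_norm, ← hpd, norm_sub_rev, ← dist_eq_norm]
    exact infDist_le_dist_of_mem hs
  have hball : ball x ‖x - p‖ ⊆ U := fun s hs => by
    by_contra hsU
    exact (hfar s hsU).not_gt (mem_ball_iff_norm.1 hs)
  obtain ⟨b, hb, hab, hxb⟩ := exists_reflection_of_notMem_convex hUo hUc hpU ha hx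
  have hup := le_log_norm_sub_of_harmonic_of_frontier hUo hUb ha hh hc hbd hb hab hx
  have hr : 0 < ‖x - a‖ := norm_pos_iff.2 (sub_ne_zero.2 hxa)
  have hd : 0 < ‖x - p‖ := norm_pos_iff.2 (sub_ne_zero.2 (ne_of_mem_of_not_mem hx hpU))
  have hxb0 : 0 < ‖x - b‖ := hr.trans_le (hab x (subset_closure hx))
  set r := ‖x - a‖
  set d := ‖x - p‖
  have hlog : ∀ t > 0, log ‖x - b‖ - log t ≤ (‖x - b‖ ^ 2 / t ^ 2 - 1) / 2 := by
    intro t ht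
    have h1 := log_le_sub_one_of_pos (x := (‖x - b‖ / t) ^ 2) (by positivity)
    rw [log_pow, log_div hxb0.ne' ht.ne', div_pow] at h1
    push_cast at h1
    linarith
  rcases lt_or_ge d (2 * r) with hdr | hdr
  · have hρ : 0 < min d r := lt_min hd hr
    have hsub : ∀ z ∈ ball x (min d r), z ∈ U ∧ z ≠ a := fun z hz =>
      ⟨hball (ball_subset_ball (min_le_left _ _) hz), by
        rintro rfl
        rw [mem_ball_iff_norm, norm_sub_rev] at hz
        exact (min_le_right d r).not_gt hz⟩
    have hg := norm_fderiv_le_of_harmonicOnNhd_of_nonneg (u := h - fun z => log ‖z - a‖) hρ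
      (fun z hz => (hh z (hsub z hz).1).sub (harmonicAt_log_norm_sub (hsub z hz).2))
      (fun z hz => sub_nonneg.2 (log_norm_sub_le_of_harmonic_of_frontier hUo hUb ha hh hc hbd
        (hsub z hz).1 (hsub z hz).2))
    have hsplit : fderiv ℝ h x = fderiv ℝ (h - fun z => log ‖z - a‖) x +
        fderiv ℝ (fun z : ℂ => log ‖z - a‖) x := by
      rw [fderiv_sub ((hh x hx).1.differentiableAt (by norm_num))
        ((harmonicAt_log_norm_sub hxa).1.differentiableAt (by norm_num)), sub_add_cancel]
    have hgx : h x - log ‖x - a‖ ≤ 6 * d / r := by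
      have h1 := hlog r hr
      have h2 : (‖x - b‖ ^ 2 / r ^ 2 - 1) / 2 ≤ 6 * d / r := by
        rw [div_sub_one (by positivity), div_div, div_le_div_iff₀ (by positivity) hr]
        nlinarith [mul_pos hd hr, mul_pos (mul_pos hd hr) (sub_pos.2 hdr)]
      linarith
    have hρd : d / 2 ≤ min d r := le_min (by linarith) (by linarith)
    have hg' : ‖fderiv ℝ (h - fun z => log ‖z - a‖) x‖ ≤ 24 / r := by
      refine hg.trans ?_
      rw [div_le_div_iff₀ hρ hr]
      rw [le_div_iff₀ hr] at hgx
      have : (h - fun z => log ‖z - a‖) x = h x - log ‖x - a‖ := rfl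
      rw [this]
      nlinarith
    rw [hsplit]
    refine (norm_add_le _ _).trans ((add_le_add hg' (norm_fderiv_log_norm_sub_le hxa)).trans_eq ?_)
    rw [← add_div]
    norm_num
  · have hma : ∀ s ∉ U, d / 2 ≤ ‖s - a‖ := fun s hs => by
      have h1 := hfar s hs
      have h2 := norm_sub_le_norm_sub_add_norm_sub s a x
      rw [norm_sub_rev a x] at h2
      linarith
    have hg := norm_fderiv_le_of_harmonicOnNhd_of_nonneg (u := fun z => h z - log (d / 2)) hd
      (fun z hz => (hh z (hball hz)).sub (harmonicAt_const _))
      (fun z hz => sub_nonneg.2 (log_le_of_harmonic_of_frontier hUo hUb hh hc hbd (half_pos hd) hma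
        (hball hz)))
    rw [fderiv_sub_const] at hg
    refine hg.trans ?_
    have h1 := hlog (d / 2) (half_pos hd)
    have h2 : (‖x - b‖ ^ 2 / (d / 2) ^ 2 - 1) / 2 ≤ 12 := by
      have : ‖x - b‖ ^ 2 / (d / 2) ^ 2 ≤ 25 := by
        rw [div_le_iff₀ (by positivity)]
        nlinarith
      linarith
    rw [div_le_div_iff₀ hd hr]
    nlinarith

end LogBoundaryData

open InnerProductSpace Laplacian in
/-- The coordinate form of the Laplace equation on an open subset of the Euclidean plane, pulled
back to `ℂ` along the isometry sending `1, I` to the standard basis. -/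
theorem harmonicOnNhd_comp_orthonormalBasisOneI_repr {U : Set E2} (hUo : IsOpen U) {Ψ : E2 → ℝ}
    (hΨ : ContDiffOn ℝ 2 Ψ U)
    (hΔ : ∀ x ∈ U,
      (fderivWithin ℝ (fun y => fderivWithin ℝ Ψ U y (EuclideanSpace.single 0 1)) U x)
        (EuclideanSpace.single 0 1) +
      (fderivWithin ℝ (fun y => fderivWithin ℝ Ψ U y (EuclideanSpace.single 1 1)) U x)
        (EuclideanSpace.single 1 1) = 0) :
    HarmonicOnNhd (Ψ ∘ Complex.orthonormalBasisOneI.repr)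
      (Complex.orthonormalBasisOneI.repr ⁻¹' U) := by
  set L := Complex.orthonormalBasisOneI.repr
  have hL1 : L 1 = EuclideanSpace.single 0 1 := by
    simpa using Complex.orthonormalBasisOneI.repr_self 0
  have hLI : L Complex.I = EuclideanSpace.single 1 1 := by
    simpa using Complex.orthonormalBasisOneI.repr_self 1
  have hUo' : IsOpen (L ⁻¹' U) := hUo.preimage L.continuous
  have hsecond : ∀ x ∈ U, ∀ v : E2,
      (fderivWithin ℝ (fun y => fderivWithin ℝ Ψ U y v) U x) v =
        iteratedFDeriv ℝ 2 Ψ x ![v, v] := by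
    intro x hx v
    have hC : ContDiffAt ℝ 2 Ψ x := hΨ.contDiffAt (hUo.mem_nhds hx)
    have hev : (fun y => fderivWithin ℝ Ψ U y v) =ᶠ[nhds x] fun y => fderiv ℝ Ψ y v := by
      filter_upwards [hUo.mem_nhds hx] with y hy
      rw [fderivWithin_of_isOpen hUo hy]
    have hD : DifferentiableAt ℝ (fderiv ℝ Ψ) x :=
      (hC.fderiv_right (m := 1) (by norm_num)).differentiableAt (by norm_num)
    rw [fderivWithin_of_isOpen hUo hx, hev.fderiv_eq, iteratedFDeriv_two_apply,
      fderiv_clm_apply hD (by fun_prop)]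
    simp
  intro z hz
  refine ⟨(hΨ.contDiffAt (hUo.mem_nhds hz)).comp z L.contDiff.contDiffAt, ?_⟩
  filter_upwards [hUo'.mem_nhds hz] with w hw
  have hcomp : iteratedFDeriv ℝ 2 (Ψ ∘ L) w = (iteratedFDeriv ℝ 2 Ψ (L w)).compContinuousLinearMap
      fun _ => (L.toContinuousLinearEquiv : ℂ →L[ℝ] E2) := by
    simpa [iteratedFDerivWithin_univ] using
      L.toContinuousLinearEquiv.iteratedFDerivWithin_comp_right Ψ uniqueDiffOn_univ
        (x := w) (Set.mem_univ _) 2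
  simp only [laplacian_eq_iteratedFDeriv_complexPlane, hcomp]
  have h := hΔ (L w) hw
  rw [hsecond _ hw, hsecond _ hw, ← hL1, ← hLI] at h
  simp only [Pi.zero_apply, ContinuousMultilinearMap.compContinuousLinearMap_apply]
  convert h using 3 <;> (ext i; fin_cases i <;> rfl)

/-- Domain-independent gradient bound for the harmonic correction of the logarithmic
singularity: if Ψ is harmonic in a bounded convex domain U with boundary values
−(1/2π) log|s−x'|, then |∇Ψ(x)| ≤ C/|x−x'| with C independent of U. -/
theorem stmt6 :
    ∃ C : ℝ, 0 < C ∧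
      ∀ (U : Set E2), IsOpen U → Convex ℝ U → Bornology.IsBounded U →
      ∀ x' ∈ U, ∀ Ψ : E2 → ℝ,
      ContDiffOn ℝ 2 Ψ U →
      -- Ψ harmonic in U
      (∀ x ∈ U,
        (fderivWithin ℝ (fun y => fderivWithin ℝ Ψ U y (EuclideanSpace.single 0 1)) U x)
          (EuclideanSpace.single 0 1) +
        (fderivWithin ℝ (fun y => fderivWithin ℝ Ψ U y (EuclideanSpace.single 1 1)) U x)
          (EuclideanSpace.single 1 1) = 0) →
      ContinuousOn Ψ (closure U) →
      -- Dirichlet boundary data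
      (∀ s ∈ frontier U, Ψ s = -(1 / (2 * π)) * Real.log ‖s - x'‖) →
      ∀ x ∈ U, x ≠ x' → ‖fderivWithin ℝ Ψ U x‖ ≤ C / ‖x - x'‖ := by
  refine ⟨28, by norm_num, ?_⟩
  intro U hUo hUc hUb x' hx' Ψ hΨ hΔ hc hbd x hx hxx'
  set L := Complex.orthonormalBasisOneI.repr
  have hcl : closure (L ⁻¹' U) = L ⁻¹' closure U :=
    (L.toHomeomorph.preimage_closure U).symm
  have hfr : frontier (L ⁻¹' U) = L ⁻¹' frontier U :=
    (L.toHomeomorph.preimage_frontier U).symm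
  have hdist : ∀ s t : ℂ, ‖s - t‖ = ‖L s - L t‖ := fun s t => by
    rw [← map_sub, L.norm_map]
  have hπ : (0 : ℝ) < 2 * π := by positivity
  have hmain := norm_fderiv_le_of_harmonic_of_frontier (U := L ⁻¹' U) (a := L.symm x')
    (h := (-(2 * π)) • (Ψ ∘ L)) (x := L.symm x) (hUo.preimage L.continuous)
    (hUc.linear_preimage L.toLinearEquiv.toLinearMap)
    (L.antilipschitz.isBounded_preimage hUb) (by simpa using hx')
    (fun z hz => ((harmonicOnNhd_comp_orthonormalBasisOneI_repr hUo hΨ hΔ) z hz).const_smul)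
    (by
      rw [hcl]
      exact (hc.comp L.continuous.continuousOn fun z hz => hz).const_smul _)
    (by
      rw [hfr]
      intro s hs
      rw [hdist, L.apply_symm_apply]
      simp only [Pi.smul_apply, Function.comp_apply, hbd _ hs, smul_eq_mul]
      field_simp)
    (by simpa using hx) (by simpa using hxx')
  have hD : DifferentiableAt ℝ Ψ x :=
    (hΨ.contDiffAt (hUo.mem_nhds hx)).differentiableAt (by norm_num)
  have hcomp : fderiv ℝ (Ψ ∘ L) (L.symm x) =
      (fderiv ℝ Ψ x).comp (L.toContinuousLinearEquiv : ℂ →L[ℝ] E2) := by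
    have := L.toContinuousLinearEquiv.comp_right_fderiv (f := Ψ) (x := L.symm x)
    simpa using this
  have hnorm : ‖fderiv ℝ (Ψ ∘ L) (L.symm x)‖ = ‖fderiv ℝ Ψ x‖ := by
    rw [hcomp]
    exact ContinuousLinearMap.opNorm_comp_linearIsometryEquiv _ L
  have hDL : DifferentiableAt ℝ (Ψ ∘ L) (L.symm x) :=
    DifferentiableAt.comp _ (by simpa using hD) L.differentiableAt
  rw [fderiv_const_smul hDL, norm_smul, hnorm, hdist, L.apply_symm_apply, L.apply_symm_apply,
    norm_neg, Real.norm_of_nonneg hπ.le] at hmain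
  rw [fderivWithin_of_isOpen hUo hx]
  refine le_trans ?_ hmain
  have : 1 ≤ 2 * π := by linarith [pi_gt_three]
  exact le_mul_of_one_le_left (norm_nonneg _) this
end
end

section
/- Let z : ℝ² \ {0} → ℝ be a function whose extended gradient ∇z is smooth on ℝ² \ {0} and satisfies |∇³z(x)| ≤ K|x|^{−3}. For a bond b = (ξ, ξ + a) with midpoint m and symmetric neighbourhood ω_b (the union of the two triangles adjacent to b, symmetric about m), the difference between the bond average and the cell average, ∫₀¹ ∇z(ξ + ta)·a dt − (1/|ω_b|)∫_{ω_b} ∇z·a dx, is bounded in absolute value by C K dist(b, 0)^{−3} when dist(b, 0) ≥ 2, where C is a universal constant. -/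
noncomputable section
open Real MeasureTheory Metric RealInnerProductSpace

/-- First-order Taylor estimate on a unit ball, from a bound on the second derivative. -/
theorem norm_sub_sub_fderiv_le_of_norm_iteratedFDeriv_two_le
    {E F : Type*} [NormedAddCommGroup E] [NormedSpace ℝ E] [NormedAddCommGroup F]
    [NormedSpace ℝ F] {f : E → F} {m : E} {M : ℝ}
    (hf : ∀ x ∈ ball m 1, ContDiffAt ℝ 2 f x)
    (hM : ∀ x ∈ ball m 1, ‖iteratedFDeriv ℝ 2 f x‖ ≤ M) {x : E} (hx : x ∈ ball m 1) :
    ‖f x - f m - fderiv ℝ f m (x - m)‖ ≤ M := by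
  have hm : m ∈ ball m (1 : ℝ) := mem_ball_self one_pos
  have hM0 : 0 ≤ M := (norm_nonneg _).trans (hM m hm)
  have hdf : ∀ y ∈ ball m (1 : ℝ), DifferentiableAt ℝ (fderiv ℝ f) y := fun y hy =>
    ((hf y hy).fderiv_right (m := 1) (by norm_num)).differentiableAt one_ne_zero
  have hbd : ∀ y ∈ ball m (1 : ℝ), ‖fderiv ℝ (fderiv ℝ f) y‖ ≤ M := fun y hy => by
    rw [← norm_iteratedFDeriv_one, norm_iteratedFDeriv_fderiv]
    exact hM y hy
  have hle : ∀ y ∈ ball m (1 : ℝ), M * ‖y - m‖ ≤ M := fun y hy =>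
    mul_le_of_le_one_right hM0 (mem_ball_iff_norm.1 hy).le
  refine ((convex_ball m 1).norm_image_sub_le_of_norm_fderivWithin_le' ?_ ?_ hm hx).trans
    (hle x hx)
  · exact fun y hy =>
      ((hf y hy).differentiableAt two_ne_zero).differentiableWithinAt
  · intro y hy
    rw [fderivWithin_of_isOpen isOpen_ball hy]
    exact ((convex_ball m 1).norm_image_sub_le_of_norm_fderiv_le hdf hbd hm hy).trans (hle y hy)

/-- A linear form centred at `m` integrates to zero over a set that is point-symmetric about `m`. -/
theorem setIntegral_apply_sub_eq_zero_of_pointSymmetric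
    {E : Type*} [NormedAddCommGroup E] [NormedSpace ℝ E] [MeasurableSpace E] [BorelSpace E]
    {μ : Measure E} [μ.IsAddLeftInvariant] [μ.IsNegInvariant]
    (L : E →L[ℝ] ℝ) {m : E} {s : Set E} (hs : MeasurableSet s)
    (hsymm : ∀ x, x ∈ s ↔ (2 : ℝ) • m - x ∈ s) :
    ∫ x in s, L (x - m) ∂μ = 0 := by
  have hrefl := integral_sub_left_eq_self (s.indicator fun x => L (x - m)) μ ((2 : ℝ) • m)
  have hodd : ∀ x, s.indicator (fun x => L (x - m)) ((2 : ℝ) • m - x) =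
      -s.indicator (fun x => L (x - m)) x := by
    intro x
    by_cases hx : x ∈ s
    · rw [Set.indicator_of_mem hx, Set.indicator_of_mem ((hsymm x).1 hx), ← map_neg]
      congr 1
      module
    · rw [Set.indicator_of_notMem hx, Set.indicator_of_notMem (mt (hsymm x).2 hx), neg_zero]
  simp_rw [hodd] at hrefl
  rw [integral_neg, integral_indicator hs] at hrefl
  linarith

/-- The average over a point-symmetric set differs from the central value by at most the
first-order Taylor remainder. -/
theorem abs_setAverage_sub_le_of_pointSymmetric {g : E2 → ℝ} {m : E2} {L : E2 →L[ℝ] ℝ} {M : ℝ}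
    {s : Set E2} (hs : MeasurableSet s) (hpos : 0 < volume s)
    (hsymm : ∀ x, x ∈ s ↔ (2 : ℝ) • m - x ∈ s) (hball : s ⊆ ball m 1)
    (hg : ContinuousOn g (ball m 1))
    (hM : ∀ x ∈ ball m 1, |g x - g m - L (x - m)| ≤ M) :
    |(volume s).toReal⁻¹ * (∫ x in s, g x) - g m| ≤ M := by
  have hfin : volume s < ⊤ := (measure_mono hball).trans_lt measure_ball_lt_top
  have hV : 0 < (volume s).toReal := ENNReal.toReal_pos hpos.ne' hfin.ne
  have hbound : ∀ x ∈ s, ‖g x - g m - L (x - m)‖ ≤ M := fun x hx => hM x (hball hx)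
  have hLcont : Continuous fun x => L (x - m) := by fun_prop
  have hL : IntegrableOn (fun x => L (x - m)) s :=
    (hLcont.continuousOn.integrableOn_compact (isCompact_closedBall m 1)).mono_set
      (hball.trans ball_subset_closedBall)
  have hr : IntegrableOn (fun x => g x - g m - L (x - m)) s :=
    .of_bound hfin
      ((((hg.mono hball).sub continuousOn_const).sub hLcont.continuousOn).aestronglyMeasurable hs)
      M ((ae_restrict_iff' hs).2 (.of_forall hbound))
  have hc : IntegrableOn (fun _ => g m) s := integrableOn_const hfin.ne
  have hcL : IntegrableOn (fun x => g m + L (x - m)) s := hc.add hL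
  have hsplit : ∫ x in s, g x =
      (volume s).toReal * g m + ∫ x in s, (g x - g m - L (x - m)) := by
    calc ∫ x in s, g x
        = ∫ x in s, ((g m + L (x - m)) + (g x - g m - L (x - m))) := by
          congr 1 with x
          ring
      _ = _ := by
          rw [integral_add hcL hr, integral_add hc hL,
            setIntegral_apply_sub_eq_zero_of_pointSymmetric L hs hsymm, setIntegral_const]
          simp [Measure.real]
  have hrem := norm_setIntegral_le_of_norm_le_const hfin hbound
  rw [hsplit, mul_add, inv_mul_cancel_left₀ hV.ne', add_sub_cancel_left, abs_mul,
    abs_of_pos (inv_pos.2 hV), inv_mul_le_iff₀ hV, mul_comm]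
  exact hrem

theorem add_smul_mem_ball_midpoint {ξ a : E2} (ha : ‖a‖ = 1) {t : ℝ} (ht : t ∈ Set.Icc (0 : ℝ) 1) :
    ξ + t • a ∈ ball (ξ + (2 : ℝ)⁻¹ • a) 1 := by
  rw [mem_ball_iff_norm, add_sub_add_left_eq_sub, ← sub_smul, norm_smul, ha, mul_one,
    Real.norm_eq_abs, abs_lt]
  constructor <;> linarith [ht.1, ht.2]

/-- The average along a unit segment differs from the midpoint value by at most the
first-order Taylor remainder. -/
theorem abs_segmentAverage_sub_le {g : E2 → ℝ} {ξ a : E2} (ha : ‖a‖ = 1)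
    {L : E2 →L[ℝ] ℝ} {M : ℝ} (hg : ContinuousOn g (ball (ξ + (2 : ℝ)⁻¹ • a) 1))
    (hM : ∀ x ∈ ball (ξ + (2 : ℝ)⁻¹ • a) 1,
      |g x - g (ξ + (2 : ℝ)⁻¹ • a) - L (x - (ξ + (2 : ℝ)⁻¹ • a))| ≤ M) :
    |(∫ t in (0 : ℝ)..1, g (ξ + t • a)) - g (ξ + (2 : ℝ)⁻¹ • a)| ≤ M := by
  have hgi : IntervalIntegrable (fun t : ℝ => g (ξ + t • a)) volume 0 1 := by
    apply ContinuousOn.intervalIntegrable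
    rw [Set.uIcc_of_le zero_le_one]
    exact hg.comp (by fun_prop) fun t ht => add_smul_mem_ball_midpoint ha ht
  have hlin : Continuous fun t : ℝ => g (ξ + (2 : ℝ)⁻¹ • a) + (t - 2⁻¹) * L a := by fun_prop
  have hval : ∫ t in (0 : ℝ)..1, (g (ξ + (2 : ℝ)⁻¹ • a) + (t - 2⁻¹) * L a) =
      g (ξ + (2 : ℝ)⁻¹ • a) := by
    rw [intervalIntegral.integral_add (by simp) (Continuous.intervalIntegrable (by fun_prop) _ _),
      intervalIntegral.integral_mul_const, intervalIntegral.integral_sub (by simp) (by simp)]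
    norm_num
  rw [← hval, ← intervalIntegral.integral_sub hgi (hlin.intervalIntegrable _ _)]
  have hrem : ∀ t ∈ Set.uIoc (0 : ℝ) 1,
      ‖g (ξ + t • a) - (g (ξ + (2 : ℝ)⁻¹ • a) + (t - 2⁻¹) * L a)‖ ≤ M := by
    intro t ht
    rw [Set.uIoc_of_le zero_le_one] at ht
    have h := hM _ (add_smul_mem_ball_midpoint (ξ := ξ) ha ⟨ht.1.le, ht.2⟩)
    rw [add_sub_add_left_eq_sub, ← sub_smul, map_smul, smul_eq_mul] at h
    rwa [Real.norm_eq_abs, ← sub_sub]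
  simpa using intervalIntegral.norm_integral_le_of_norm_le_const hrem

/-- Midpoint-symmetry cancellation: for a field G = ∇z smooth on ℝ² \ {0} with
|∇²G| = |∇³z| ≤ K|x|⁻³, the difference between the bond average of G·a along a unit
bond b = (ξ, ξ+a) and the average of G·a over a point-symmetric neighbourhood ω_b of
the bond midpoint is bounded by C K dist(b,0)⁻³. -/
theorem stmt11 :
    ∃ C : ℝ, 0 < C ∧
      ∀ (G : E2 → E2) (K : ℝ), 0 ≤ K →
      ContDiffOn ℝ (⊤ : ℕ∞) G {(0 : E2)}ᶜ →
      (∀ x : E2, x ≠ 0 →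
        ‖iteratedFDerivWithin ℝ 2 G {(0 : E2)}ᶜ x‖ ≤ K / ‖x‖ ^ 3) →
      ∀ (ξ a : E2), ‖a‖ = 1 →
      ∀ (ω : Set E2), MeasurableSet ω → 0 < MeasureTheory.volume ω →
      -- ω is point-symmetric about the bond midpoint m = ξ + a/2
      (∀ x : E2, x ∈ ω ↔ (2 : ℝ) • (ξ + (2 : ℝ)⁻¹ • a) - x ∈ ω) →
      -- ω consists of the cells adjacent to the bond
      ω ⊆ ball (ξ + (2 : ℝ)⁻¹ • a) 1 →
      -- the bond is at distance at least 2 from the origin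
      2 ≤ ‖ξ + (2 : ℝ)⁻¹ • a‖ →
      |(∫ t in (0 : ℝ)..1, ⟪G (ξ + t • a), a⟫) -
          ((MeasureTheory.volume ω).toReal)⁻¹ * ∫ x in ω, ⟪G x, a⟫| ≤
        C * K / ‖ξ + (2 : ℝ)⁻¹ • a‖ ^ 3 := by
  refine ⟨16, by norm_num, fun G K hK hG hbd ξ a ha ω hω hpos hsymm hball hm => ?_⟩
  set m : E2 := ξ + (2 : ℝ)⁻¹ • a
  have hmpos : 0 < ‖m‖ := by linarith
  have hfar : ∀ x ∈ ball m 1, ‖m‖ / 2 ≤ ‖x‖ := fun x hx => by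
    have h1 : ‖m - x‖ < 1 := mem_ball_iff_norm'.1 hx
    linarith [norm_sub_norm_le m x]
  have hne : ∀ x ∈ ball m 1, x ≠ 0 := fun x hx =>
    norm_pos_iff.1 ((half_pos hmpos).trans_le (hfar x hx))
  have hopen : IsOpen ({(0 : E2)}ᶜ) := isOpen_compl_singleton
  have hsmooth : ∀ x ∈ ball m 1, ContDiffAt ℝ 2 G x := fun x hx =>
    (hG.contDiffAt (hopen.mem_nhds (hne x hx))).of_le (WithTop.coe_le_coe.2 le_top)
  have hsecond : ∀ x ∈ ball m 1, ‖iteratedFDeriv ℝ 2 G x‖ ≤ 8 * K / ‖m‖ ^ 3 := fun x hx => by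
    rw [← iteratedFDerivWithin_of_isOpen 2 hopen (hne x hx)]
    calc _ ≤ K / ‖x‖ ^ 3 := hbd x (hne x hx)
      _ ≤ K / (‖m‖ / 2) ^ 3 := by
        have := hfar x hx
        gcongr
      _ = 8 * K / ‖m‖ ^ 3 := by
        field_simp
        norm_num
  have htaylor : ∀ x ∈ ball m 1,
      |⟪G x, a⟫ - ⟪G m, a⟫ - ((innerSL ℝ a).comp (fderiv ℝ G m)) (x - m)| ≤
        8 * K / ‖m‖ ^ 3 := fun x hx => by
    have h : ⟪G x, a⟫ - ⟪G m, a⟫ - ((innerSL ℝ a).comp (fderiv ℝ G m)) (x - m) =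
        ⟪G x - G m - fderiv ℝ G m (x - m), a⟫ := by
      simp [inner_sub_left, inner_sub_right, real_inner_comm]
    rw [h]
    calc _ ≤ ‖G x - G m - fderiv ℝ G m (x - m)‖ * ‖a‖ := abs_real_inner_le_norm _ _
      _ ≤ _ := by
        rw [ha, mul_one]
        exact norm_sub_sub_fderiv_le_of_norm_iteratedFDeriv_two_le hsmooth hsecond hx
  have hcont : ContinuousOn (fun x => ⟪G x, a⟫) (ball m 1) :=
    ContinuousOn.inner (fun x hx => (hsmooth x hx).continuousAt.continuousWithinAt)
      continuousOn_const
  have hbond := abs_segmentAverage_sub_le ha hcont htaylor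
  have hcell := abs_setAverage_sub_le_of_pointSymmetric hω hpos hsymm hball hcont htaylor
  calc _ ≤ _ := abs_sub_le _ ⟪G m, a⟫ _
    _ ≤ 8 * K / ‖m‖ ^ 3 + 8 * K / ‖m‖ ^ 3 := by
      rw [abs_sub_comm ⟪G m, a⟫]
      exact add_le_add hbond hcell
    _ = 16 * K / ‖m‖ ^ 3 := by ring
end
end
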